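/- arXiv:2010.01511 — 3 statements merged into one kernel-verified Lean document; each statement's English description precedes it below -/
import Mathlib

section
/- Let M̂(P) denote the minimum of |z| over the complex roots z of a nonconstant polynomial P, and set Φ_r(x) = x^{r+1} − 2x^r + x − 1 and Ψ_r(x) = x^{r+1} − x^r − x^{r−1} − ⋯ − x − 1. Then for every fixed integer r ≥ 1 and each choice of sign ±: lim_{n→∞} M̂(Φ_r(x)·xⁿ ± (x^r + 1)(x − 1)) = 1; lim_{n→∞} M̂(Ψ_r(x)·xⁿ ± (x^{r+1} − 1)) = 1; and lim_{n→∞} M̂(Ψ_r(x)·xⁿ ± (x^{r−1} + x^{r−2} + ⋯ + x + 1)) = 1. -/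
open Polynomial

/-- The minimal absolute value of the complex roots of a polynomial `P`. -/
noncomputable def minRootAbs (P : Polynomial ℂ) : ℝ :=
  sInf ((fun z : ℂ => ‖z‖) '' {z : ℂ | P.eval z = 0})

theorem Multiset.one_lt_prod_norm {s : Multiset ℂ} (hs : s ≠ 0) (h : ∀ z ∈ s, 1 < ‖z‖) :
    1 < ‖s.prod‖ := by
  induction s using Multiset.induction_on with
  | empty => exact absurd rfl hs
  | cons a s ih =>
    have ha : 1 < ‖a‖ := h a (Multiset.mem_cons_self a s)
    rw [Multiset.prod_cons, norm_mul]
    rcases eq_or_ne s 0 with rfl | hs'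
    · simpa using ha
    · exact one_lt_mul_of_lt_of_le ha (ih hs' fun z hz => h z (Multiset.mem_cons_of_mem hz)).le

theorem Polynomial.Monic.exists_root_norm_le_one {P : ℂ[X]} (hP : P.Monic)
    (hdeg : P.natDegree ≠ 0) (h0 : ‖P.eval 0‖ = 1) : ∃ z, P.eval z = 0 ∧ ‖z‖ ≤ 1 := by
  by_contra! h
  have hsplit := IsAlgClosed.splits P
  have hroots : P.roots ≠ 0 := by
    intro h
    apply hdeg
    rw [hsplit.natDegree_eq_card_roots, h, Multiset.card_zero]
  have hlt := Multiset.one_lt_prod_norm hroots fun z hz => h z (isRoot_of_mem_roots hz)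
  rw [← coeff_zero_eq_eval_zero, hsplit.coeff_zero_eq_prod_roots_of_monic hP] at h0
  simp only [norm_mul, norm_pow, norm_neg, norm_one, one_pow, one_mul] at h0
  exact hlt.ne' h0

theorem eventually_norm_lt_of_isRoot {A B : ℂ[X]} (hB : ∀ z : ℂ, ‖z‖ < 1 → B.eval z ≠ 0)
    {ρ : ℝ} (hρ0 : 0 ≤ ρ) (hρ1 : ρ < 1) :
    ∀ᶠ n : ℕ in Filter.atTop, ∀ z : ℂ, (A * X ^ n + B).eval z = 0 → ρ < ‖z‖ := by
  have hK : IsCompact (Metric.closedBall (0 : ℂ) ρ) := isCompact_closedBall 0 ρ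
  obtain ⟨M, hM⟩ := hK.exists_bound_of_continuousOn A.continuous.continuousOn
  obtain ⟨w, hw, hmin⟩ := hK.exists_isMinOn (Metric.nonempty_closedBall.mpr hρ0)
    B.continuous.norm.continuousOn
  have hm : 0 < ‖B.eval w‖ :=
    norm_pos_iff.mpr (hB w ((mem_closedBall_zero_iff.mp hw).trans_lt hρ1))
  have hlim : Filter.Tendsto (fun n : ℕ => M * ρ ^ n) Filter.atTop (nhds 0) := by
    simpa using (tendsto_pow_atTop_nhds_zero_of_lt_one hρ0 hρ1).const_mul M
  filter_upwards [hlim.eventually_lt_const hm] with n hn z hz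
  by_contra! hle
  have hzK : z ∈ Metric.closedBall (0 : ℂ) ρ := mem_closedBall_zero_iff.mpr hle
  have hMz := hM z hzK
  have hBz : ‖B.eval w‖ ≤ ‖B.eval z‖ := hmin hzK
  rw [eval_add, eval_mul, eval_pow, eval_X, add_comm, add_eq_zero_iff_eq_neg] at hz
  rw [hz, norm_neg, norm_mul, norm_pow] at hBz
  have : ‖A.eval z‖ * ‖z‖ ^ n ≤ M * ρ ^ n := by
    gcongr
    exact (norm_nonneg _).trans hMz
  linarith

theorem tendsto_minRootAbs {A B : ℂ[X]} (hA : A.Monic) (hB0 : ‖B.eval 0‖ = 1)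
    (hB : ∀ z : ℂ, ‖z‖ < 1 → B.eval z ≠ 0) :
    Filter.Tendsto (fun n : ℕ => minRootAbs (A * X ^ n + B)) Filter.atTop (nhds 1) := by
  have hroot : ∀ᶠ n : ℕ in Filter.atTop, ∃ z, (A * X ^ n + B).eval z = 0 ∧ ‖z‖ ≤ 1 := by
    filter_upwards [Filter.eventually_gt_atTop B.natDegree] with n hn
    have hAX : (A * X ^ n).Monic := hA.mul (monic_X_pow n)
    have hdegAX : (A * X ^ n).natDegree = A.natDegree + n := by
      rw [hA.natDegree_mul (monic_X_pow n), natDegree_X_pow]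
    have hlt : B.natDegree < (A * X ^ n).natDegree := by omega
    refine (hAX.add_of_left (degree_lt_degree hlt)).exists_root_norm_le_one ?_ ?_
    · rw [natDegree_add_eq_left_of_natDegree_lt hlt]
      omega
    · have hn0 : n ≠ 0 := by omega
      simpa [hn0] using hB0
  have hbdd (P : ℂ[X]) : BddBelow ((fun z : ℂ => ‖z‖) '' {z : ℂ | P.eval z = 0}) :=
    ⟨0, by rintro _ ⟨z, -, rfl⟩; exact norm_nonneg z⟩
  refine tendsto_order.mpr ⟨fun a ha => ?_, fun a ha => ?_⟩
  · obtain ⟨ρ, haρ, hρ1⟩ := exists_between (max_lt ha zero_lt_one)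
    filter_upwards [hroot, eventually_norm_lt_of_isRoot (A := A) hB
      ((le_max_right a 0).trans haρ.le) hρ1] with n ⟨z, hz, _⟩ hn
    refine ((le_max_left a 0).trans_lt haρ).trans_le (le_csInf ⟨_, z, hz, rfl⟩ ?_)
    rintro _ ⟨w, hw, rfl⟩
    exact (hn w hw).le
  · filter_upwards [hroot] with n ⟨z, hz, hz1⟩
    exact ((csInf_le (hbdd _) ⟨z, hz, rfl⟩).trans hz1).trans_lt ha

theorem pow_ne_of_norm_lt_one {z c : ℂ} (hz : ‖z‖ < 1) (hc : ‖c‖ = 1) {k : ℕ} (hk : k ≠ 0) :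
    z ^ k ≠ c := by
  rintro rfl
  rw [norm_pow] at hc
  exact (pow_lt_one₀ (norm_nonneg z) hz hk).ne hc

theorem monic_X_pow_sub_geom_sum (r : ℕ) :
    (X ^ (r + 1) - ∑ i ∈ Finset.range (r + 1), X ^ i : ℂ[X]).Monic := by
  refine monic_X_pow_sub ((degree_sum_le _ _).trans_lt ?_)
  rw [Finset.sup_lt_iff (WithBot.bot_lt_coe _)]
  intro i hi
  rw [degree_X_pow]
  exact_mod_cast Finset.mem_range.mp hi

theorem monic_X_pow_sub_two_mul_X_pow_add_X_sub_one (r : ℕ) (hr : 1 ≤ r) :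
    (X ^ (r + 1) - 2 * X ^ r + X - 1 : ℂ[X]).Monic := by
  have hdeg : (-2 * X ^ r + X - 1 : ℂ[X]).natDegree ≤ r := by
    compute_degree!
  convert monic_X_pow_add (n := r + 1) (p := (-2 * X ^ r + X - 1 : ℂ[X])) ?_ using 1
  · ring
  · exact (degree_le_of_natDegree_le hdeg).trans_lt (by exact_mod_cast Nat.lt_succ_self r)

theorem stmt_14 (r : ℕ) (hr : 1 ≤ r) (ε : ℂ) (hε : ε = 1 ∨ ε = -1) :
    Filter.Tendsto
      (fun n : ℕ => minRootAbs
        ((X ^ (r + 1) - 2 * X ^ r + X - 1) * X ^ n + C ε * ((X ^ r + 1) * (X - 1))))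
      Filter.atTop (nhds 1) ∧
    Filter.Tendsto
      (fun n : ℕ => minRootAbs
        ((X ^ (r + 1) - ∑ i ∈ Finset.range (r + 1), X ^ i) * X ^ n
          + C ε * (X ^ (r + 1) - 1)))
      Filter.atTop (nhds 1) ∧
    Filter.Tendsto
      (fun n : ℕ => minRootAbs
        ((X ^ (r + 1) - ∑ i ∈ Finset.range (r + 1), X ^ i) * X ^ n
          + C ε * (∑ i ∈ Finset.range r, X ^ i)))
      Filter.atTop (nhds 1) := by
  have hr0 : r ≠ 0 := Nat.one_le_iff_ne_zero.mp hr
  have hnorm : ‖ε‖ = 1 := by rcases hε with rfl | rfl <;> simp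
  have hε0 : ε ≠ 0 := norm_ne_zero_iff.mp (hnorm ▸ one_ne_zero)
  refine ⟨tendsto_minRootAbs (monic_X_pow_sub_two_mul_X_pow_add_X_sub_one r hr) ?_ fun z hz => ?_,
    tendsto_minRootAbs (monic_X_pow_sub_geom_sum r) ?_ fun z hz => ?_,
    tendsto_minRootAbs (monic_X_pow_sub_geom_sum r) ?_ fun z hz => ?_⟩
  · simp [hr0, hnorm]
  · have h1 : z ^ r + 1 ≠ 0 := fun h =>
      pow_ne_of_norm_lt_one hz (c := -1) (by simp) hr0 (eq_neg_of_add_eq_zero_left h)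
    have h2 : z - 1 ≠ 0 := sub_ne_zero.mpr fun h => by simp [h] at hz
    simpa using ⟨hε0, h1, h2⟩
  · simp [hnorm]
  · simpa using ⟨hε0, sub_ne_zero.mpr (pow_ne_of_norm_lt_one hz norm_one r.succ_ne_zero)⟩
  · obtain ⟨k, rfl⟩ := Nat.exists_eq_succ_of_ne_zero hr0
    simp [Finset.sum_range_succ', eval_finsetSum, hnorm]
  · have hsum : ∑ i ∈ Finset.range r, z ^ i ≠ 0 := fun h =>
      pow_ne_of_norm_lt_one hz norm_one hr0 <| sub_eq_zero.mp <| by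
        rw [← geom_sum_mul, h, zero_mul]
    simpa [eval_finsetSum] using ⟨hε0, hsum⟩
end

section
/- Let M̂(P) denote the minimum of |z| over the complex roots z of a nonconstant polynomial P, and set Φ_r(x) = x^{r+1} − 2x^r + x − 1. For each fixed integer r ≥ 3, define κ_{A,r} = M̂(x^r − x^{r−1} + 1) and κ_{B,r} = M̂(x^r − x + 1). Then κ_{A,r} < 1 and κ_{B,r} < 1, and for each choice of sign ±: lim_{n→∞} M̂(Φ_r(x)·xⁿ ± (x^r − x^{r−1} + 1)) = κ_{A,r} and lim_{n→∞} M̂(Φ_r(x)·xⁿ ± (x^r − x + 1)) = κ_{B,r}. -/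
open Polynomial

/-- Every root of `P` bounds `minRootAbs P` from above. -/
theorem minRootAbs_le_norm {P : ℂ[X]} {z : ℂ} (hz : P.eval z = 0) : minRootAbs P ≤ ‖z‖ :=
  csInf_le ⟨0, by rintro _ ⟨w, -, rfl⟩; exact norm_nonneg w⟩ ⟨z, hz, rfl⟩

/-- The infimum in `minRootAbs` is attained. -/
theorem exists_eval_eq_zero_norm_eq_minRootAbs {P : ℂ[X]} (hP : P ≠ 0)
    (hroot : ∃ z, P.eval z = 0) : ∃ z, P.eval z = 0 ∧ ‖z‖ = minRootAbs P := by
  have hfin : {z : ℂ | P.eval z = 0}.Finite := P.finite_setOfPred_isRoot hP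
  obtain ⟨z, hz, hn⟩ := (Set.Nonempty.image (fun z : ℂ => ‖z‖) hroot).csInf_mem (hfin.image _)
  exact ⟨z, hz, hn⟩

/-- On a compact subset of the open unit disc free of zeros of `Q`, the polynomials `F Xⁿ + ε Q`
are eventually bounded away from zero. -/
theorem eventually_le_norm_eval_mul_X_pow_add (F Q : ℂ[X]) {ε : ℂ} (hε : ‖ε‖ = 1) {K : Set ℂ}
    (hK : IsCompact K) {ρ : ℝ} (hρ₀ : 0 ≤ ρ) (hρ₁ : ρ < 1) (hKρ : ∀ z ∈ K, ‖z‖ ≤ ρ)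
    (hQ : ∀ z ∈ K, Q.eval z ≠ 0) :
    ∃ δ > 0, ∀ᶠ n : ℕ in Filter.atTop, ∀ z ∈ K, δ ≤ ‖(F * X ^ n + C ε * Q).eval z‖ := by
  obtain ⟨δ, hδ, hδQ⟩ := hK.exists_forall_le' (f := fun z => ‖Q.eval z‖) (a := 0)
    Q.continuous.norm.continuousOn fun z hz => norm_pos_iff.2 (hQ z hz)
  obtain ⟨M, hM⟩ := hK.exists_bound_of_continuousOn F.continuous.continuousOn
  refine ⟨δ / 2, half_pos hδ, ?_⟩
  have hlim : Filter.Tendsto (fun n : ℕ => M * ρ ^ n) Filter.atTop (nhds 0) := by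
    simpa using (tendsto_pow_atTop_nhds_zero_of_lt_one hρ₀ hρ₁).const_mul M
  filter_upwards [hlim.eventually_lt_const (half_pos hδ)] with n hn z hz
  have hF : ‖F.eval z * z ^ n‖ ≤ M * ρ ^ n := by
    rw [norm_mul, norm_pow]
    exact mul_le_mul (hM z hz) (pow_le_pow_left₀ (norm_nonneg z) (hKρ z hz) n) (by positivity)
      ((norm_nonneg _).trans (hM z hz))
  have hεQ : ‖ε * Q.eval z‖ = ‖Q.eval z‖ := by rw [norm_mul, hε, one_mul]
  have htri := norm_sub_le_norm_add (ε * Q.eval z) (F.eval z * z ^ n)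
  rw [add_comm] at htri
  have := hδQ z hz
  simp only [eval_add, eval_mul, eval_pow, eval_X, eval_C]
  linarith

/-- A polynomial whose value at the centre of a disc is smaller than all its values on the
boundary circle has a zero in the closed disc. -/
theorem exists_eval_eq_zero_mem_closedBall {P : ℂ[X]} {c : ℂ} {s δ : ℝ} (hs : 0 < s)
    (hδ : 0 < δ) (hsphere : ∀ z ∈ Metric.sphere c s, δ ≤ ‖P.eval z‖) (hc : ‖P.eval c‖ < δ) :
    ∃ z ∈ Metric.closedBall c s, P.eval z = 0 := by
  by_contra! hne
  have hd : DiffContOnCl ℂ (fun z => P.eval z)⁻¹ (Metric.ball c s) :=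
    P.differentiable.diffContOnCl.inv fun z hz => hne z (by rwa [closure_ball c hs.ne'] at hz)
  have hle := Complex.norm_le_of_forall_mem_frontier_norm_le Metric.isBounded_ball hd
    (C := δ⁻¹) (fun z hz => ?_) (subset_closure (Metric.mem_ball_self hs))
  · rw [Pi.inv_apply, norm_inv] at hle
    have hpos : 0 < ‖P.eval c‖ := norm_pos_iff.2 (hne c (Metric.mem_closedBall_self hs.le))
    exact hc.not_ge ((inv_le_inv₀ hpos hδ).1 hle)
  · rw [frontier_ball c hs.ne'] at hz
    rw [Pi.inv_apply, norm_inv]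
    exact inv_anti₀ hδ (hsphere z hz)

/-- Each root of `Q` in the open unit disc is a limit of roots of `F Xⁿ + ε Q`. -/
theorem eventually_exists_root_norm_sub_le (F : ℂ[X]) {Q : ℂ[X]} (hQ : Q ≠ 0) {ε : ℂ}
    (hε : ‖ε‖ = 1) {c : ℂ} (hc : Q.eval c = 0) (hc₁ : ‖c‖ < 1) {η : ℝ} (hη : 0 < η) :
    ∀ᶠ n : ℕ in Filter.atTop, ∃ z, ‖z - c‖ ≤ η ∧ (F * X ^ n + C ε * Q).eval z = 0 := by
  have hfin : {z : ℂ | Q.eval z = 0}.Finite := Q.finite_setOfPred_isRoot hQ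
  obtain ⟨s, ⟨hs₀, hs⟩, hsQ⟩ :=
    ((Set.Ioo_infinite (lt_min hη (sub_pos.2 hc₁))).sdiff
      (hfin.image fun z => dist z c)).nonempty
  rw [lt_min_iff] at hs
  obtain ⟨δ, hδ, hev⟩ := eventually_le_norm_eval_mul_X_pow_add F Q hε (isCompact_sphere c s)
    (ρ := ‖c‖ + s) (by positivity) (by linarith [hs.2])
    (fun z hz => by
      have := norm_le_norm_add_norm_sub c z
      rw [mem_sphere_iff_norm, norm_sub_rev] at hz
      linarith)
    (fun z hz h => hsQ ⟨z, h, hz⟩)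
  have hlim : Filter.Tendsto (fun n : ℕ => ‖F.eval c‖ * ‖c‖ ^ n) Filter.atTop (nhds 0) := by
    simpa using (tendsto_pow_atTop_nhds_zero_of_lt_one (norm_nonneg c) hc₁).const_mul ‖F.eval c‖
  filter_upwards [hev, hlim.eventually_lt_const hδ] with n hn hn'
  obtain ⟨z, hz, hz₀⟩ := exists_eval_eq_zero_mem_closedBall hs₀ hδ hn (by simpa [hc] using hn')
  exact ⟨z, (mem_closedBall_iff_norm.1 hz).trans hs.1.le, hz₀⟩

/-- If `Q` has a root in the open unit disc, then the minimal absolute value of the roots of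
`F Xⁿ + ε Q` tends to that of `Q`. -/
theorem tendsto_minRootAbs_mul_X_pow_add (F : ℂ[X]) {Q : ℂ[X]} (hQ : Q ≠ 0)
    (hroot : ∃ z, Q.eval z = 0) (hlt : minRootAbs Q < 1) {ε : ℂ} (hε : ‖ε‖ = 1) :
    Filter.Tendsto (fun n : ℕ => minRootAbs (F * X ^ n + C ε * Q)) Filter.atTop
      (nhds (minRootAbs Q)) := by
  obtain ⟨c, hc, hcn⟩ := exists_eval_eq_zero_norm_eq_minRootAbs hQ hroot
  have hnear {η : ℝ} (hη : 0 < η) :=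
    eventually_exists_root_norm_sub_le F hQ hε hc (hcn.trans_lt hlt) hη
  refine tendsto_order.2 ⟨fun a ha => ?_, fun a ha => ?_⟩
  · obtain ⟨ρ, haρ, hρ⟩ := exists_between ha
    rcases lt_or_ge ρ 0 with hneg | hρ₀
    · refine Filter.Eventually.of_forall fun n => (haρ.trans hneg).trans_le ?_
      exact Real.sInf_nonneg (by rintro _ ⟨w, -, rfl⟩; exact norm_nonneg w)
    · obtain ⟨δ, hδ, hev⟩ := eventually_le_norm_eval_mul_X_pow_add F Q hε
        (isCompact_closedBall (0 : ℂ) ρ) hρ₀ (hρ.trans hlt)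
        (fun z hz => mem_closedBall_zero_iff.1 hz)
        (fun z hz h => ((mem_closedBall_zero_iff.1 hz).trans_lt hρ).not_ge (minRootAbs_le_norm h))
      filter_upwards [hev, hnear one_pos] with n hn hex
      obtain ⟨z, -, hz⟩ := hex
      refine haρ.trans_le (le_csInf ⟨_, z, hz, rfl⟩ ?_)
      rintro _ ⟨w, hw, rfl⟩
      by_contra! hlt
      have := hn w (mem_closedBall_zero_iff.2 hlt.le)
      rw [hw, norm_zero] at this
      exact this.not_gt hδ
  · filter_upwards [hnear (half_pos (sub_pos.2 ha))] with n hn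
    obtain ⟨z, hz, hz₀⟩ := hn
    have h₁ := minRootAbs_le_norm hz₀
    have h₂ := norm_le_norm_add_norm_sub c z
    rw [norm_sub_rev] at h₂
    linarith

/-- A monic polynomial with constant coefficient of absolute value one, all of whose roots on the
unit circle have real part `1 / 2`, has a root inside the unit disc as soon as the real part of
the sum of its roots is not half its degree. -/
theorem minRootAbs_lt_one_of_monic {P : ℂ[X]} (hP : P.Monic) (h₀ : ‖P.coeff 0‖ = 1)
    (hcirc : ∀ z : ℂ, P.eval z = 0 → ‖z‖ = 1 → z.re = 1 / 2)
    (hsum : (-P.nextCoeff).re ≠ P.natDegree / 2) : minRootAbs P < 1 := by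
  by_contra! hge
  have hsplit : P.Splits := IsAlgClosed.splits P
  have hroot {z : ℂ} (hz : z ∈ P.roots) : P.eval z = 0 := (mem_roots'.1 hz).2
  have hle {z : ℂ} (hz : z ∈ P.roots) : 1 ≤ ‖z‖ := hge.trans (minRootAbs_le_norm (hroot hz))
  have hprod : (P.roots.map fun z => ‖z‖).prod = 1 := by
    have := congrArg norm (hsplit.coeff_zero_eq_prod_roots_of_monic hP)
    rw [h₀, norm_mul, norm_pow, norm_neg, norm_one, one_pow, one_mul] at this
    rw [this]
    exact (map_multiset_prod (normHom : ℂ →*₀ ℝ) P.roots).symm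
  have hone {z : ℂ} (hz : z ∈ P.roots) : ‖z‖ = 1 := by
    refine le_antisymm ?_ (hle hz)
    obtain ⟨t, ht⟩ := Multiset.exists_cons_of_mem hz
    rw [ht, Multiset.map_cons, Multiset.prod_cons] at hprod
    have ht₁ : 1 ≤ (t.map fun z => ‖z‖).prod :=
      Multiset.one_le_prod_map fun w hw => hle (ht ▸ Multiset.mem_cons_of_mem hw)
    nlinarith [norm_nonneg z]
  refine hsum ?_
  rw [hsplit.nextCoeff_eq_neg_sum_roots_of_monic hP, neg_neg]
  have hre : P.roots.sum.re = (P.roots.map Complex.re).sum :=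
    map_multiset_sum Complex.reAddGroupHom P.roots
  rw [hre, Multiset.map_congr rfl fun z hz => hcirc z (hroot hz) (hone hz)]
  simp [hsplit.natDegree_eq_card_roots, div_eq_mul_inv]

/-- A point of the unit circle at distance one from `1` has real part `1 / 2`. -/
theorem re_eq_half_of_norm_sub_one_eq_one {z : ℂ} (hz : ‖z‖ = 1) (h : ‖z - 1‖ = 1) :
    z.re = 1 / 2 := by
  have h₁ := Complex.sq_norm z
  have h₂ := Complex.sq_norm (z - 1)
  rw [hz, Complex.normSq_apply] at h₁
  rw [h, Complex.normSq_apply] at h₂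
  simp at h₂
  linarith

theorem monic_natDegree_X_pow_sub_X_pow_add_one {r k : ℕ} (hk : k < r) :
    (X ^ r - X ^ k + 1 : ℂ[X]).Monic ∧ (X ^ r - X ^ k + 1 : ℂ[X]).natDegree = r := by
  have hdeg : (-X ^ k + 1 : ℂ[X]).degree < r := by
    refine (degree_add_le _ _).trans_lt (max_lt ?_ ?_)
    · simpa using hk
    · simpa using (Nat.zero_le k).trans_lt hk
  have heq : (X ^ r - X ^ k + 1 : ℂ[X]) = X ^ r + (-X ^ k + 1) := by ring
  rw [heq]
  refine ⟨monic_X_pow_add hdeg, ?_⟩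
  rw [natDegree_add_eq_left_of_degree_lt (by simpa using hdeg), natDegree_X_pow]

/-- The trinomials `X ^ r - X ^ k + 1` with `k = 1` or `k = r - 1` have a root in the open unit
disc. -/
theorem minRootAbs_X_pow_sub_X_pow_add_one_lt_one {r k : ℕ} (hr : 3 ≤ r)
    (hk : k = 1 ∨ k = r - 1) : minRootAbs (X ^ r - X ^ k + 1) < 1 := by
  have hkr : k < r := by omega
  have hk₀ : k ≠ 0 := by omega
  obtain ⟨hmonic, hdeg⟩ := monic_natDegree_X_pow_sub_X_pow_add_one hkr
  refine minRootAbs_lt_one_of_monic hmonic ?_ (fun z hz hn => ?_) ?_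
  · simp [coeff_X_pow, hk₀.symm, (show 0 ≠ r by omega)]
  · refine re_eq_half_of_norm_sub_one_eq_one hn ?_
    simp only [eval_add, eval_sub, eval_pow, eval_X, eval_one] at hz
    rcases hk with rfl | rfl
    · have h : z - 1 = z ^ r := by linear_combination -hz
      rw [h, norm_pow, hn, one_pow]
    · obtain ⟨m, rfl⟩ : ∃ m, r = m + 1 := ⟨r - 1, by omega⟩
      have h : z ^ m * (z - 1) = -1 := by
        rw [Nat.add_sub_cancel] at hz
        linear_combination hz
      simpa [hn] using congrArg norm h
  · rw [nextCoeff_of_natDegree_pos (by omega), hdeg]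
    have h3 : (3 : ℝ) ≤ r := by exact_mod_cast hr
    have hcoeff : ((-(X ^ r - X ^ k + 1 : ℂ[X]).coeff (r - 1)).re) ≤ 1 := by
      simp only [coeff_add, coeff_sub, coeff_X_pow, coeff_one, (show r - 1 ≠ r by omega),
        (show r - 1 ≠ 0 by omega), if_false]
      split_ifs <;> simp
    exact ne_of_lt (by linarith)

theorem stmt_15 (r : ℕ) (hr : 3 ≤ r) :
    minRootAbs (X ^ r - X ^ (r - 1) + 1) < 1 ∧
    minRootAbs (X ^ r - X + 1) < 1 ∧
    ∀ ε : ℂ, (ε = 1 ∨ ε = -1) →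
      Filter.Tendsto
        (fun n : ℕ => minRootAbs
          ((X ^ (r + 1) - 2 * X ^ r + X - 1) * X ^ n + C ε * (X ^ r - X ^ (r - 1) + 1)))
        Filter.atTop (nhds (minRootAbs (X ^ r - X ^ (r - 1) + 1))) ∧
      Filter.Tendsto
        (fun n : ℕ => minRootAbs
          ((X ^ (r + 1) - 2 * X ^ r + X - 1) * X ^ n + C ε * (X ^ r - X + 1)))
        Filter.atTop (nhds (minRootAbs (X ^ r - X + 1))) := by
  have hmain (k : ℕ) (hk : k = 1 ∨ k = r - 1) (F : ℂ[X]) {ε : ℂ} (hε : ‖ε‖ = 1) :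
      Filter.Tendsto (fun n : ℕ => minRootAbs (F * X ^ n + C ε * (X ^ r - X ^ k + 1)))
        Filter.atTop (nhds (minRootAbs (X ^ r - X ^ k + 1))) := by
    obtain ⟨hmonic, hdeg⟩ := monic_natDegree_X_pow_sub_X_pow_add_one (show k < r by omega)
    refine tendsto_minRootAbs_mul_X_pow_add F hmonic.ne_zero ?_
      (minRootAbs_X_pow_sub_X_pow_add_one_lt_one hr hk) hε
    exact IsAlgClosed.exists_root _ (natDegree_pos_iff_degree_pos.1 (by omega)).ne'
  have hlt := minRootAbs_X_pow_sub_X_pow_add_one_lt_one hr (.inl rfl)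
  rw [pow_one] at hlt
  refine ⟨minRootAbs_X_pow_sub_X_pow_add_one_lt_one hr (.inr rfl), hlt, fun ε hε => ?_⟩
  have hn : ‖ε‖ = 1 := by rcases hε with rfl | rfl <;> simp
  have hone := hmain 1 (.inl rfl) (X ^ (r + 1) - 2 * X ^ r + X - 1) hn
  rw [pow_one] at hone
  exact ⟨hmain (r - 1) (.inr rfl) _ hn, hone⟩
end

section
/- Every Pisot number q with 1 < q < 2 whose minimal polynomial over ℚ has degree at most 150 satisfies: every Galois conjugate q' of q has |q'| ≥ (√5 − 1)/2. -/
/-- A Pisot number: a real algebraic integer `q > 1` all of whose Galois conjugates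
(the complex roots of its minimal polynomial over `ℚ` other than `q` itself)
have absolute value less than `1`. -/
def IsPisot (q : ℝ) : Prop :=
  1 < q ∧ IsIntegral ℤ q ∧
    ∀ z : ℂ, Polynomial.aeval z (minpoly ℚ q) = 0 → z ≠ (q : ℂ) → ‖z‖ < 1

/-- `z` is a Galois conjugate of `q`: a complex root of the minimal polynomial of `q`
over `ℚ` other than `q` itself. -/
def IsPisotConj (q : ℝ) (z : ℂ) : Prop :=
  Polynomial.aeval z (minpoly ℚ q) = 0 ∧ z ≠ (q : ℂ)


open Polynomial in
/-- The complex roots `α` of a monic integer polynomial with constant coefficient `±1` have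
integral sums `∑ α` and `∑ α⁻¹`. -/
theorem exists_int_eq_sum_roots_and_sum_inv_roots {P : ℤ[X]} (hP : P.Monic)
    (h0 : IsUnit (P.coeff 0)) :
    (∃ a : ℤ, (P.map (Int.castRingHom ℂ)).roots.sum = a) ∧
      ∃ b : ℤ, ((P.map (Int.castRingHom ℂ)).roots.map fun w ↦ w⁻¹).sum = b := by
  have hs : (P.map (Int.castRingHom ℂ)).Splits := IsAlgClosed.splits _
  have hm : (P.map (Int.castRingHom ℂ)).Monic := hP.map _
  refine ⟨⟨-P.nextCoeff, ?_⟩, ⟨-P.coeff 1 * P.coeff 0, ?_⟩⟩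
  · have h := hs.nextCoeff_eq_neg_sum_roots_of_monic hm
    rw [nextCoeff_map (RingHom.injective_int _)] at h
    push_cast
    rw [← neg_eq_iff_eq_neg, ← h, eq_intCast]
  · have he : (P.map (Int.castRingHom ℂ)).eval 0 = P.coeff 0 := by
      simp [← coeff_zero_eq_eval_zero]
    have he' : (P.map (Int.castRingHom ℂ)).derivative.eval 0 = P.coeff 1 := by
      simp [← coeff_zero_eq_eval_zero, coeff_derivative]
    have h := hs.eval_derivative_div_eval_of_ne_zero (x := 0)
      (by rw [he]; exact_mod_cast h0.ne_zero)
    simp only [zero_sub, one_div, inv_neg, Multiset.sum_map_neg, he, he'] at h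
    rw [← neg_eq_iff_eq_neg.2 h]
    rcases Int.isUnit_iff.1 h0 with h1 | h1 <;> simp [h1, div_neg]

/-- The elementary symmetric data of a Pisot number `q < 2`: it is a unit, and its trace and the
trace of its inverse are integers. -/
theorem IsPisot.exists_conjugates {q : ℝ} (hq : IsPisot q) (h2 : q < 2) :
    ∃ S : Multiset ℂ, (∀ w, w ∈ S ↔ IsPisotConj q w) ∧ q * (S.map norm).prod = 1 ∧
      (∃ a : ℤ, q + S.sum = a) ∧ ∃ b : ℤ, (q : ℂ)⁻¹ + (S.map fun w ↦ w⁻¹).sum = b := by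
  classical
  obtain ⟨h1, hint, hconj⟩ := hq
  set P := minpoly ℤ q
  have hPQ : minpoly ℚ q = P.map (algebraMap ℤ ℚ) :=
    minpoly.isIntegrallyClosed_eq_field_fractions' ℚ hint
  set F := P.map (Int.castRingHom ℂ) with hF
  have hFQ : F = (minpoly ℚ q).map (algebraMap ℚ ℂ) := by
    rw [hPQ, Polynomial.map_map, hF]; congr 1
  have hm : P.Monic := minpoly.monic hint
  have hmF : F.Monic := hm.map _
  have hintQ : IsIntegral ℚ q := hint.tower_top
  have hnodup : F.roots.Nodup := by
    rw [hFQ]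
    exact Polynomial.nodup_roots (minpoly.irreducible hintQ).separable.map
  have hmem (w : ℂ) : w ∈ F.roots ↔ Polynomial.aeval w (minpoly ℚ q) = 0 := by
    rw [Polynomial.mem_roots hmF.ne_zero, Polynomial.IsRoot.def, hFQ,
      Polynomial.eval_map_algebraMap]
  have hqF : (q : ℂ) ∈ F.roots := by
    rw [hmem]
    have := Polynomial.aeval_algebraMap_apply ℂ q (minpoly ℚ q)
    rw [minpoly.aeval, map_zero] at this
    exact this
  have hcons : (q : ℂ) ::ₘ F.roots.erase q = F.roots := Multiset.cons_erase hqF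
  have hS (w : ℂ) : w ∈ F.roots.erase q ↔ IsPisotConj q w := by
    rw [hnodup.mem_erase_iff, hmem, IsPisotConj, and_comm]
  have hprod : q * ((F.roots.erase q).map norm).prod = |(P.coeff 0 : ℝ)| := by
    have h := (IsAlgClosed.splits F).coeff_zero_eq_prod_roots_of_monic hmF
    apply_fun norm at h
    rw [hF, Polynomial.coeff_map, ← hF, ← hcons] at h
    simp only [eq_intCast, Complex.norm_intCast, norm_mul, norm_pow, norm_neg, norm_one, one_pow,
      one_mul, Multiset.prod_cons, Complex.norm_real, Real.norm_eq_abs] at h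
    rw [h, abs_of_pos (by linarith)]
    congr 1
    exact (map_multiset_prod (normHom : ℂ →*₀ ℝ) _).symm
  have hle : ((F.roots.erase q).map norm).prod ≤ 1 := by
    simpa using Multiset.prod_map_le_prod_map₀ norm (fun _ ↦ (1 : ℝ)) (fun w _ ↦ norm_nonneg w)
      fun w hw ↦ (hconj w ((hS w).1 hw).1 ((hS w).1 hw).2).le
  have hunit : IsUnit (P.coeff 0) := by
    have hlt : |P.coeff 0| < 2 := by
      have : |(P.coeff 0 : ℝ)| < 2 := by rw [← hprod]; nlinarith
      exact_mod_cast this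
    have hne : P.coeff 0 ≠ 0 := by
      have h := minpoly.coeff_zero_ne_zero hintQ (zero_lt_one.trans h1).ne'
      rw [hPQ, Polynomial.coeff_map] at h
      simpa using h
    rw [Int.isUnit_iff]
    rw [abs_lt] at hlt
    omega
  obtain ⟨ha, hb⟩ := exists_int_eq_sum_roots_and_sum_inv_roots hm hunit
  rw [← hF, ← hcons] at ha hb
  simp only [Multiset.sum_cons, Multiset.map_cons] at ha hb
  refine ⟨F.roots.erase q, hS, ?_, ha, hb⟩
  rw [hprod]
  rcases Int.isUnit_iff.1 hunit with h | h <;> simp [h]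

theorem abs_re_sub_inv_le {w : ℂ} (h0 : w ≠ 0) (h1 : ‖w‖ ≤ 1) :
    |(w - w⁻¹).re| ≤ ‖w‖⁻¹ - ‖w‖ := by
  have hpos : 0 < ‖w‖ := norm_pos_iff.2 h0
  have h : (w - w⁻¹).re = w.re / ‖w‖ * (‖w‖ - ‖w‖⁻¹) := by
    rw [Complex.sub_re, Complex.inv_re, Complex.normSq_eq_norm_sq]
    field_simp
  have hinv : 1 ≤ ‖w‖⁻¹ := (one_le_inv₀ hpos).2 h1
  have hre : |w.re / ‖w‖| ≤ 1 := by
    rw [abs_div, abs_norm]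
    exact div_le_one_of_le₀ (Complex.abs_re_le_norm w) (norm_nonneg w)
  rw [h, abs_mul, abs_of_nonpos (by linarith : ‖w‖ - ‖w‖⁻¹ ≤ 0)]
  nlinarith

/-- `t ↦ t⁻¹ - t` is superadditive with respect to multiplication on `(0, 1]`. -/
theorem inv_sub_self_add_le_of_le_one {s t : ℝ} (hs : 0 < s) (hs1 : s ≤ 1) (ht : 0 < t)
    (ht1 : t ≤ 1) : (s⁻¹ - s) + (t⁻¹ - t) ≤ (s * t)⁻¹ - s * t := by
  have h : (s * t)⁻¹ - s * t - ((s⁻¹ - s) + (t⁻¹ - t)) =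
      (1 - s) * (1 - t) * (1 - s * t) / (s * t) := by
    field_simp
    ring
  have : 0 ≤ (1 - s) * (1 - t) * (1 - s * t) / (s * t) := by
    have := mul_le_one₀ hs1 ht.le ht1
    exact div_nonneg (mul_nonneg (mul_nonneg (by linarith) (by linarith)) (by linarith))
      (by positivity)
  linarith

theorem Multiset.abs_re_sum_sub_inv_le (R : Multiset ℂ)
    (hR : ∀ w ∈ R, w ≠ 0 ∧ ‖w‖ ≤ 1) :
    0 < (R.map norm).prod ∧ (R.map norm).prod ≤ 1 ∧
      |(R.map fun w ↦ w - w⁻¹).sum.re| ≤ (R.map norm).prod⁻¹ - (R.map norm).prod := by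
  induction R using Multiset.induction_on with
  | empty => simp
  | cons w R ih =>
    obtain ⟨h0, h1, h⟩ := ih fun v hv ↦ hR v (mem_cons_of_mem hv)
    obtain ⟨hw0, hw1⟩ := hR w (mem_cons_self w R)
    have hpos : 0 < ‖w‖ := norm_pos_iff.2 hw0
    simp only [map_cons, prod_cons, sum_cons, Complex.add_re]
    refine ⟨by positivity, mul_le_one₀ hw1 h0.le h1, ?_⟩
    calc _ ≤ _ := abs_add_le _ _
      _ ≤ _ := add_le_add (abs_re_sub_inv_le hw0 hw1) h
      _ ≤ _ := inv_sub_self_add_le_of_le_one hpos hw1 h0 h1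

/-- Bounds on `q - q⁻¹ + (y - y⁻¹)`, perturbed by at most `q / y - y / q`, when `y` exceeds the
golden ratio. -/
theorem two_lt_and_lt_three_of_abs_le {q y r : ℝ} (hy0 : 0 < y) (hy : y + 1 < y ^ 2) (hyq : y ≤ q)
    (hq : q < 2) (hr : |r| ≤ q / y - y / q) :
    2 < q - q⁻¹ + (y - y⁻¹) + r ∧ q - q⁻¹ + (y - y⁻¹) + r < 3 := by
  have hy1 : 1 < y := by nlinarith
  have hq0 : 0 < q := by linarith
  rw [abs_le] at hr
  have hqy : 0 < q * y := by positivity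
  constructor
  · have h : q - q⁻¹ + (y - y⁻¹) - (q / y - y / q) - 2 =
        (2 * y * (y ^ 2 - y - 1) + (q - y) * (3 * (y ^ 2 - y - 1) + (2 - y))
          + (q - y) ^ 2 * (y - 1)) / (q * y) := by
      field_simp
      ring
    have : 0 < (2 * y * (y ^ 2 - y - 1) + (q - y) * (3 * (y ^ 2 - y - 1) + (2 - y))
          + (q - y) ^ 2 * (y - 1)) / (q * y) := by
      refine div_pos (add_pos_of_pos_of_nonneg (add_pos_of_pos_of_nonneg ?_ ?_) ?_) hqy
      · exact mul_pos (by linarith) (by linarith)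
      · exact mul_nonneg (by linarith) (by linarith)
      · exact mul_nonneg (sq_nonneg _) (by linarith)
    linarith
  · have h : 3 - (q - q⁻¹ + (y - y⁻¹) + (q / y - y / q)) =
        ((q - y) * (q - 1) * (y - 1) + (2 * q + 1) * (2 - q) * y) / (q * y) := by
      field_simp
      ring
    have : 0 < ((q - y) * (q - 1) * (y - 1) + (2 * q + 1) * (2 - q) * y) / (q * y) := by
      refine div_pos (add_pos_of_nonneg_of_pos ?_ ?_) hqy
      · exact mul_nonneg (mul_nonneg (by linarith) (by linarith)) (by linarith)
      · exact mul_pos (mul_pos (by linarith) (by linarith)) hy0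
    linarith

/-- Bounds on `q - q⁻¹ - (y - y⁻¹)`, perturbed by at most `q / y - y / q`, when `y` exceeds the
golden ratio. -/
theorem pos_and_lt_one_of_abs_le {q y r : ℝ} (hy0 : 0 < y) (hy : y + 1 < y ^ 2) (hyq : y < q)
    (hq : q < 2) (hr : |r| ≤ q / y - y / q) :
    0 < q - q⁻¹ - (y - y⁻¹) + r ∧ q - q⁻¹ - (y - y⁻¹) + r < 1 := by
  have hy1 : 1 < y := by nlinarith
  have hq0 : 0 < q := by linarith
  rw [abs_le] at hr
  have hqy : 0 < q * y := by positivity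
  constructor
  · have h : q - q⁻¹ - (y - y⁻¹) - (q / y - y / q) =
        (q - y) * (q - 1) * (y - 1) / (q * y) := by
      field_simp
      ring
    have : 0 < (q - y) * (q - 1) * (y - 1) / (q * y) :=
      div_pos (mul_pos (mul_pos (by linarith) (by linarith)) (by linarith)) hqy
    linarith
  · have h : 1 - (q - q⁻¹ - (y - y⁻¹) + (q / y - y / q)) =
        ((2 - q) * ((y + 1) * (2 + q - y) + 1) + 3 * (y ^ 2 - y - 1) + (2 * y - 3))
          / (q * y) := by
      field_simp
      ring
    have : 0 < ((2 - q) * ((y + 1) * (2 + q - y) + 1) + 3 * (y ^ 2 - y - 1) + (2 * y - 3))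
          / (q * y) := by
      refine div_pos ?_ hqy
      have : 0 ≤ (2 - q) * ((y + 1) * (2 + q - y) + 1) :=
        mul_nonneg (by linarith) (by nlinarith)
      nlinarith
    linarith

theorem stmt_19 (q : ℝ) (hq : IsPisot q) (h1 : 1 < q) (h2 : q < 2)
    (hdeg : (minpoly ℚ q).natDegree ≤ 150)
    (z : ℂ) (hz : IsPisotConj q z) :
    (Real.sqrt 5 - 1) / 2 ≤ ‖z‖ := by
  classical
  obtain ⟨S, hS, hprod, ⟨a, ha⟩, ⟨b, hb⟩⟩ := hq.exists_conjugates h2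
  have hlt : ∀ w ∈ S, w ≠ 0 ∧ ‖w‖ < 1 := fun w hw ↦ by
    refine ⟨?_, hq.2.2 w ((hS w).1 hw).1 ((hS w).1 hw).2⟩
    rintro rfl
    rw [← Multiset.cons_erase hw] at hprod
    simp at hprod
  have hzS : z ∈ S := (hS z).2 hz
  obtain ⟨R, rfl⟩ := Multiset.exists_cons_of_mem hzS
  have hR : ∀ w ∈ R, w ≠ 0 ∧ ‖w‖ ≤ 1 := fun w hw ↦
    (hlt w (Multiset.mem_cons_of_mem hw)).imp_right le_of_lt
  obtain ⟨hp0, hp1, hre⟩ := R.abs_re_sum_sub_inv_le hR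
  have hz0 : 0 < ‖z‖ := norm_pos_iff.2 (hlt z hzS).1
  have hsqrt : Real.sqrt 5 ^ 2 = 5 := Real.sq_sqrt (by norm_num)
  have hsqrt0 : 0 ≤ Real.sqrt 5 := Real.sqrt_nonneg 5
  simp only [Multiset.map_cons, Multiset.prod_cons, Multiset.sum_cons] at hprod ha hb
  set p := (R.map norm).prod with hp
  by_contra! hcon
  have hx : ‖z‖ ^ 2 + ‖z‖ < 1 := by nlinarith
  -- A non-real conjugate comes with its complex conjugate, which makes it large.
  have hreal : (z.re : ℂ) = z := by
    by_contra hne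
    have hne' : (starRingEnd ℂ) z ≠ z := fun h ↦ hne (Complex.conj_eq_iff_re.1 h)
    have hc : (starRingEnd ℂ) z ∈ z ::ₘ R := by
      rw [hS]
      refine ⟨?_, fun h ↦ hz.2 ?_⟩
      · have := Polynomial.aeval_algHom_apply (Complex.conjAe.toAlgHom.restrictScalars ℚ) z
          (minpoly ℚ q)
        rw [hz.1, map_zero] at this
        exact this
      · simpa using congrArg (starRingEnd ℂ) h
    have hcR : (starRingEnd ℂ) z ∈ R := (Multiset.mem_cons.1 hc).resolve_left hne'
    obtain ⟨R', rfl⟩ := Multiset.exists_cons_of_mem hcR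
    have hp' := (R'.abs_re_sum_sub_inv_le fun w hw ↦ hR w (Multiset.mem_cons_of_mem hw)).2.1
    simp only [Multiset.map_cons, Multiset.prod_cons, Complex.norm_conj] at hp
    have hple : p ≤ ‖z‖ := by rw [hp]; exact mul_le_of_le_one_right hz0.le hp'
    have : 1 ≤ 2 * (‖z‖ * ‖z‖) := by
      rw [← hprod]
      gcongr
    nlinarith
  have hpe : p⁻¹ = q * ‖z‖ := by
    rw [inv_eq_iff_eq_inv]
    exact eq_inv_of_mul_eq_one_right (by linarith)
  set y := ‖z‖⁻¹ with hy
  have hy0 : 0 < y := inv_pos.2 hz0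
  have hzy : ‖z‖ = y⁻¹ := (inv_inv _).symm
  have hyy : y + 1 < y ^ 2 := by
    rw [hzy] at hx
    field_simp at hx
    linarith
  have hyq : y ≤ q := by
    have : 1 ≤ q * ‖z‖ := hpe ▸ (one_le_inv₀ hp0).2 hp1
    rwa [hy, inv_le_iff_one_le_mul₀ hz0]
  have hr : |(R.map fun w ↦ w - w⁻¹).sum.re| ≤ q / y - y / q := by
    rw [← inv_inv p, hpe, hzy] at hre
    simpa [div_eq_mul_inv, mul_comm] using hre
  have hT : ((a - b : ℤ) : ℝ) =
      q - q⁻¹ + (z.re - z.re⁻¹) + (R.map fun w ↦ w - w⁻¹).sum.re := by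
    have : ((a - b : ℤ) : ℂ) =
        q - (q : ℂ)⁻¹ + (z - z⁻¹) + (R.map fun w ↦ w - w⁻¹).sum := by
      rw [Multiset.sum_map_sub, Multiset.map_id', Int.cast_sub, ← ha, ← hb]
      ring
    rw [← hreal] at this
    have := congrArg Complex.re this
    simpa [← Complex.ofReal_inv] using this
  have habs : |z.re| = y⁻¹ := by
    rw [← hzy]
    conv_rhs => rw [← hreal, Complex.norm_real, Real.norm_eq_abs]
  rcases abs_eq_abs.1 (habs.trans (abs_of_pos (inv_pos.2 hy0)).symm) with h | h
  · rw [h, inv_inv] at hT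
    rcases hyq.lt_or_eq with hlt' | heq
    · have := pos_and_lt_one_of_abs_le hy0 hyy hlt' h2 hr
      have h3 : (0 : ℝ) < ((a - b : ℤ) : ℝ) := by rw [hT]; linarith
      have h4 : ((a - b : ℤ) : ℝ) < 1 := by rw [hT]; linarith
      norm_cast at h3 h4
      omega
    · have hR0 : R = 0 := by
        by_contra hne
        obtain ⟨w, hw⟩ := Multiset.exists_mem_of_ne_zero hne
        obtain ⟨R', rfl⟩ := Multiset.exists_cons_of_mem hw
        have hp' := (R'.abs_re_sum_sub_inv_le fun w hw ↦ hR w (Multiset.mem_cons_of_mem hw))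
        have hw1 := (hlt w (Multiset.mem_cons_of_mem hw)).2
        simp only [Multiset.map_cons, Multiset.prod_cons] at hp
        have hp2 : p = 1 := by
          rw [← inv_eq_one, hpe, ← heq, hy, inv_mul_cancel₀ hz0.ne']
        nlinarith [norm_nonneg w]
      have ha' : q + q⁻¹ = a := by
        rw [hR0, ← hreal, h, heq] at ha
        have := congrArg Complex.re ha
        simpa [← Complex.ofReal_inv] using this
      have h3 : (2 : ℝ) < a := by
        rw [← ha', ← sub_pos, show q + q⁻¹ - 2 = (q - 1) ^ 2 / q by field_simp; ring]
        have : 0 < q - 1 := by linarith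
        positivity
      have h4 : (a : ℝ) < 3 := by
        rw [← ha']
        have := inv_lt_one_of_one_lt₀ h1
        linarith
      norm_cast at h3 h4
      omega
  · rw [h, inv_neg, inv_inv] at hT
    have := two_lt_and_lt_three_of_abs_le hy0 hyy hyq h2 hr
    have h3 : (2 : ℝ) < ((a - b : ℤ) : ℝ) := by rw [hT]; linarith
    have h4 : ((a - b : ℤ) : ℝ) < 3 := by rw [hT]; linarith
    norm_cast at h3 h4
    omega
end
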